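/- arXiv:2001.04158 — 13 statements merged into one kernel-verified Lean document; each statement's English description precedes it below -/
import Mathlib

section
/- Let 0 < k₋ < k₊, let r > 0 and τ ∈ ℂ with τ ≠ 0, and define u^s : ℝ → ℂ by u^s(k) = τ·exp(I·k·r)/(4π·r). Assume u^s(k₊) ≠ u^s(k₋). Then (r : ℂ) = −I·(u^s(k₊)/u^s(k₋) − 1) / (∫ k in k₋..k₊, u^s(k)/u^s(k₋)), where the integral is the interval integral over [k₋, k₊]. -/
theorem stmt_3 (kminus kplus : ℝ) (h0 : 0 < kminus) (h1 : kminus < kplus) (r : ℝ) (hr : 0 < r)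
    (τ : ℂ) (hτ : τ ≠ 0) (us : ℝ → ℂ)
    (hus : ∀ k : ℝ, us k = τ * Complex.exp (Complex.I * k * r) / (4 * Real.pi * r))
    (hne : us kplus ≠ us kminus) :
    (r : ℂ) = -Complex.I * (us kplus / us kminus - 1) / (∫ k in kminus..kplus, us k / us kminus) := by
  have hr' : (r : ℂ) ≠ 0 := by exact_mod_cast hr.ne'
  have hπ : (Real.pi : ℂ) ≠ 0 := by exact_mod_cast Real.pi_ne_zero
  have hc : Complex.I * (r : ℂ) ≠ 0 := mul_ne_zero Complex.I_ne_zero hr'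
  have hus' : ∀ k : ℝ, us k = τ / (4 * Real.pi * r) * Complex.exp (Complex.I * r * k) := by
    intro k
    rw [hus k, mul_right_comm Complex.I (k : ℂ) (r : ℂ)]
    ring
  have hu0 : us kminus ≠ 0 := by
    rw [hus']
    exact mul_ne_zero (div_ne_zero hτ (by simp [hπ, hr'])) (Complex.exp_ne_zero _)
  have hint : ∫ k in kminus..kplus, us k / us kminus
      = (us kplus - us kminus) / (Complex.I * r) / us kminus := by
    rw [intervalIntegral.integral_div]
    simp only [hus']
    rw [intervalIntegral.integral_const_mul, integral_exp_mul_complex hc]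
    ring
  have hsub : us kplus - us kminus ≠ 0 := sub_ne_zero.mpr hne
  rw [hint, div_sub_one hu0, eq_div_iff (div_ne_zero (div_ne_zero hsub hc) hu0)]
  field_simp
  simp
end

section
/- Let 0 < k₋ < k₊, let a ∈ ℝ and τ ∈ ℂ with τ ≠ 0, and define u^∞ : ℝ → ℂ by u^∞(k) = τ·exp(−I·k·a). Assume u^∞(k₊) ≠ u^∞(k₋). Then (a : ℂ) = I·(u^∞(k₊)/u^∞(k₋) − 1) / (∫ k in k₋..k₊, u^∞(k)/u^∞(k₋)), where the integral is the interval integral over [k₋, k₊]. -/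
theorem stmt_4 (kminus kplus : ℝ) (h0 : 0 < kminus) (h1 : kminus < kplus) (a : ℝ)
    (τ : ℂ) (hτ : τ ≠ 0) (uinf : ℝ → ℂ)
    (huinf : ∀ k : ℝ, uinf k = τ * Complex.exp (-Complex.I * k * a))
    (hne : uinf kplus ≠ uinf kminus) :
    (a : ℂ) = Complex.I * (uinf kplus / uinf kminus - 1) / (∫ k in kminus..kplus, uinf k / uinf kminus) := by
  have ha : (a : ℂ) ≠ 0 := by
    intro ha
    exact hne (by simp [huinf, ha])
  have hc : -Complex.I * (a : ℂ) ≠ 0 := mul_ne_zero (neg_ne_zero.mpr Complex.I_ne_zero) ha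
  have huinf' : ∀ k : ℝ, uinf k = τ * Complex.exp (-Complex.I * a * k) := fun k => by
    rw [huinf, mul_right_comm]
  have hM : uinf kminus ≠ 0 := by
    rw [huinf]
    exact mul_ne_zero hτ (Complex.exp_ne_zero _)
  have hint : ∫ k in kminus..kplus, uinf k / uinf kminus =
      (uinf kplus / uinf kminus - 1) / (-Complex.I * a) := by
    have h : ∫ k in kminus..kplus, uinf k =
        (uinf kplus - uinf kminus) / (-Complex.I * a) := by
      simp only [huinf']
      rw [intervalIntegral.integral_const_mul, integral_exp_mul_complex hc]
      ring
    rw [intervalIntegral.integral_div, h, div_right_comm, sub_div, div_self hM]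
  have hratio : uinf kplus / uinf kminus - 1 ≠ 0 := by
    rwa [sub_ne_zero, Ne, div_eq_one_iff_eq hM]
  rw [hint, div_div_eq_mul_div, mul_right_comm, mul_div_cancel_right₀ _ hratio]
  linear_combination (a : ℂ) * Complex.I_mul_I
end

section
/- Let x : Fin 4 → EuclideanSpace ℝ (Fin 3) be an affinely independent family (the four sensors are not coplanar), let z, z' ∈ EuclideanSpace ℝ (Fin 3) with z ∉ Set.range x and z' ∉ Set.range x, let τ, τ' ∈ ℂ with τ ≠ 0 and τ' ≠ 0, and let 0 < k₋ < k₊. If for every j : Fin 4 and every k ∈ Set.Ioo k₋ k₊ one has τ·exp(I·k·‖x j − z‖)/(4π·‖x j − z‖) = τ'·exp(I·k·‖x j − z'‖)/(4π·‖x j − z'‖), then z = z' and τ = τ'. -/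
/-- If two nonzero multiples of plane waves in the wavenumber agree on an open interval, their
phase rates agree. -/
theorem eq_of_mul_cexp_eqOn_Ioo {a b : ℂ} (ha : a ≠ 0) {r s k₁ k₂ : ℝ} (hk : k₁ < k₂)
    (h : ∀ k ∈ Set.Ioo k₁ k₂,
      a * Complex.exp (Complex.I * (k : ℝ) * r) = b * Complex.exp (Complex.I * (k : ℝ) * s)) :
    r = s := by
  obtain ⟨k, hmem⟩ := Set.nonempty_Ioo.2 hk
  have hderiv (c : ℂ) (t : ℝ) :
      HasDerivAt (fun k : ℝ ↦ c * Complex.exp (Complex.I * k * t))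
        (c * (Complex.exp (Complex.I * k * t) * (Complex.I * t))) k := by
    have h₁ : HasDerivAt (fun k : ℝ ↦ Complex.I * (k : ℂ) * t) (Complex.I * t) k := by
      simpa using ((Complex.ofRealCLM.hasDerivAt (x := k)).const_mul Complex.I).mul_const (t : ℂ)
    exact h₁.cexp.const_mul c
  have heq := (Filter.eventually_of_mem (isOpen_Ioo.mem_nhds hmem) h :
    (fun k : ℝ ↦ a * Complex.exp (Complex.I * k * r)) =ᶠ[nhds k]
      fun k : ℝ ↦ b * Complex.exp (Complex.I * k * s))
  have hd := (hderiv a r).unique ((hderiv b s).congr_of_eventuallyEq heq)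
  rw [← mul_assoc a, ← mul_assoc b, ← h k hmem] at hd
  have hne := mul_ne_zero ha (Complex.exp_ne_zero (Complex.I * k * r))
  exact_mod_cast mul_left_cancel₀ Complex.I_ne_zero (mul_left_cancel₀ hne hd)

/-- A point is determined by its distances to an affinely spanning family. -/
theorem eq_of_dist_eq_of_affineSpan_eq_top {ι V P : Type*} [NormedAddCommGroup V]
    [InnerProductSpace ℝ V] [MetricSpace P] [NormedAddTorsor V P] {x : ι → P}
    (hx : affineSpan ℝ (Set.range x) = ⊤) {z z' : P} (h : ∀ i, dist (x i) z = dist (x i) z') :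
    z = z' := by
  rw [← AffineSubspace.left_mem_perpBisector (p₁ := z)]
  have hle : affineSpan ℝ (Set.range x) ≤ AffineSubspace.perpBisector z z' := by
    rw [affineSpan_le]
    rintro _ ⟨i, rfl⟩
    exact AffineSubspace.mem_perpBisector_iff_dist_eq.2 (h i)
  exact hle (hx ▸ AffineSubspace.mem_top ℝ V z)

theorem stmt_5 (x : Fin 4 → EuclideanSpace ℝ (Fin 3)) (hx : AffineIndependent ℝ x)
    (z z' : EuclideanSpace ℝ (Fin 3)) (hz : z ∉ Set.range x) (hz' : z' ∉ Set.range x)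
    (τ τ' : ℂ) (hτ : τ ≠ 0) (hτ' : τ' ≠ 0)
    (kminus kplus : ℝ) (h0 : 0 < kminus) (h1 : kminus < kplus)
    (h : ∀ j : Fin 4, ∀ k ∈ Set.Ioo kminus kplus,
      τ * Complex.exp (Complex.I * k * ‖x j - z‖) / (4 * Real.pi * ‖x j - z‖) =
      τ' * Complex.exp (Complex.I * k * ‖x j - z'‖) / (4 * Real.pi * ‖x j - z'‖)) :
    z = z' ∧ τ = τ' := by
  have hne (j : Fin 4) : (4 * Real.pi * ‖x j - z‖ : ℂ) ≠ 0 := by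
    have hj : ‖x j - z‖ ≠ 0 := fun h ↦ hz ⟨j, sub_eq_zero.1 (norm_eq_zero.1 h)⟩
    exact_mod_cast mul_ne_zero (mul_ne_zero four_ne_zero Real.pi_ne_zero) hj
  have hzz : z = z' := by
    refine eq_of_dist_eq_of_affineSpan_eq_top (x := x) ?_ fun j ↦ ?_
    · exact hx.affineSpan_eq_top_iff_card_eq_finrank_add_one.2 (by simp)
    · rw [dist_eq_norm, dist_eq_norm]
      refine eq_of_mul_cexp_eqOn_Ioo (div_ne_zero hτ (hne j)) h1 (fun k hk ↦ ?_)
        (b := τ' / (4 * Real.pi * ‖x j - z'‖))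
      rw [div_mul_eq_mul_div, div_mul_eq_mul_div]
      exact h j k hk
  subst hzz
  obtain ⟨k, hk⟩ := Set.nonempty_Ioo.2 h1
  exact ⟨rfl, mul_right_cancel₀ (Complex.exp_ne_zero _) ((div_left_inj' (hne 0)).1 (h 0 k hk))⟩
end

section
/- Let n ≥ 1, let d : Fin n → EuclideanSpace ℝ (Fin n) be a linearly independent family of observation directions, let z, z' ∈ EuclideanSpace ℝ (Fin n), let τ, τ' ∈ ℂ with τ ≠ 0 and τ' ≠ 0, and let 0 < k₋ < k₊. If for every j : Fin n and every k ∈ Set.Ioo k₋ k₊ one has τ·exp(−I·k·⟪d j, z⟫) = τ'·exp(−I·k·⟪d j, z'⟫), then z = z' and τ = τ'. -/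
open scoped RealInnerProductSpace

/-- If two multiples of complex exponentials with purely imaginary rates agree near a real point,
then the rates agree. -/
theorem rate_eq_of_eventuallyEq_mul_exp {τ τ' : ℂ} (hτ : τ ≠ 0) {a b k₀ : ℝ}
    (h : (fun k : ℝ => τ * Complex.exp (-Complex.I * k * a)) =ᶠ[nhds k₀]
      fun k : ℝ => τ' * Complex.exp (-Complex.I * k * b)) : a = b := by
  have hderiv (σ : ℂ) (c : ℝ) : HasDerivAt (fun k : ℝ => σ * Complex.exp (-Complex.I * k * c))
      (σ * (Complex.exp (-Complex.I * k₀ * c) * (-Complex.I * 1 * c))) k₀ :=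
    ((((hasDerivAt_id k₀).ofReal_comp.const_mul (-Complex.I)).mul_const (c : ℂ)).cexp).const_mul σ
  have hd := (hderiv τ a).unique ((hderiv τ' b).congr_of_eventuallyEq h)
  have hv : τ * Complex.exp (-Complex.I * k₀ * a) = τ' * Complex.exp (-Complex.I * k₀ * b) :=
    h.eq_of_nhds
  rw [← mul_assoc τ, ← mul_assoc τ', ← hv] at hd
  have hc := mul_left_cancel₀ (mul_ne_zero hτ (Complex.exp_ne_zero _)) hd
  simpa using hc

theorem stmt_6 (n : ℕ) (hn : 1 ≤ n) (d : Fin n → EuclideanSpace ℝ (Fin n))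
    (hd : LinearIndependent ℝ d)
    (z z' : EuclideanSpace ℝ (Fin n)) (τ τ' : ℂ) (hτ : τ ≠ 0) (hτ' : τ' ≠ 0)
    (kminus kplus : ℝ) (h0 : 0 < kminus) (h1 : kminus < kplus)
    (h : ∀ j : Fin n, ∀ k ∈ Set.Ioo kminus kplus,
      τ * Complex.exp (-Complex.I * k * ⟪d j, z⟫) =
      τ' * Complex.exp (-Complex.I * k * ⟪d j, z'⟫)) :
    z = z' ∧ τ = τ' := by
  obtain ⟨k₀, hk₀⟩ := Set.nonempty_Ioo.2 h1
  have hinner (j : Fin n) : ⟪d j, z⟫ = ⟪d j, z'⟫ :=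
    rate_eq_of_eventuallyEq_mul_exp hτ
      (Filter.eventually_of_mem (isOpen_Ioo.mem_nhds hk₀) (h j))
  have hz : z = z' := by
    have : Nonempty (Fin n) := ⟨⟨0, hn⟩⟩
    refine InnerProductSpace.ext_inner_left_basis (𝕜 := ℝ) (basisOfLinearIndependentOfCardEqFinrank hd (by simp)) fun j => ?_
    simpa using hinner j
  subst hz
  exact ⟨rfl, mul_right_cancel₀ (Complex.exp_ne_zero _) (h ⟨0, hn⟩ k₀ hk₀)⟩
end

section
/- Let M ≥ 1, let z : Fin M → EuclideanSpace ℝ (Fin 2) be M points in the plane, and let d : Fin (M+1) → EuclideanSpace ℝ (Fin 2) be observation directions such that for all l ≠ l' the pair (d l, d l') is linearly independent over ℝ (no two directions are collinear). Then for every p ∈ EuclideanSpace ℝ (Fin 2) with p ∉ Set.range z, the number of indices l : Fin (M+1) for which there exists m : Fin M with ⟪d l, p − z m⟫ = 0 is at most M; that is, (Finset.univ.filter (fun l => ∃ m, ⟪d l, p − z m⟫ = 0)).card ≤ M. -/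
open scoped RealInnerProductSpace Classical

/-- In a real inner product space of dimension `2`, a vector orthogonal to two linearly independent
vectors vanishes. -/
theorem eq_zero_of_inner_eq_zero_of_linearIndependent_pair {E : Type*} [NormedAddCommGroup E]
    [InnerProductSpace ℝ E] (hE : Module.finrank ℝ E = 2) {a b v : E}
    (h : LinearIndependent ℝ ![a, b]) (ha : ⟪a, v⟫ = 0) (hb : ⟪b, v⟫ = 0) : v = 0 := by
  have hspan : Submodule.span ℝ (Set.range ![a, b]) = ⊤ :=
    h.span_eq_top_of_card_eq_finrank (by simp [hE])
  have hv : v ∈ Submodule.span ℝ {a, b} := by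
    rw [← Matrix.range_cons_cons_empty a b ![], hspan]
    exact Submodule.mem_top
  obtain ⟨s, t, hst⟩ := Submodule.mem_span_pair.mp hv
  have hvv : ⟪v, v⟫ = 0 := by
    nth_rewrite 1 [← hst]
    simp [inner_add_left, real_inner_smul_left, ha, hb]
  exact inner_self_eq_zero.mp hvv

theorem stmt_7 (M : ℕ) (hM : 1 ≤ M) (z : Fin M → EuclideanSpace ℝ (Fin 2))
    (d : Fin (M + 1) → EuclideanSpace ℝ (Fin 2))
    (hd : ∀ l l' : Fin (M + 1), l ≠ l' → LinearIndependent ℝ ![d l, d l'])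
    (p : EuclideanSpace ℝ (Fin 2)) (hp : p ∉ Set.range z) :
    (Finset.univ.filter (fun l : Fin (M + 1) => ∃ m : Fin M, ⟪d l, p - z m⟫ = 0)).card ≤ M := by
  by_contra! hlt
  have huniv := Finset.eq_univ_of_card
    (Finset.univ.filter fun l : Fin (M + 1) => ∃ m : Fin M, ⟪d l, p - z m⟫ = 0)
    (le_antisymm (Finset.card_le_univ _) (by simpa using hlt))
  have hex : ∀ l, ∃ m, ⟪d l, p - z m⟫ = 0 := by
    simpa [Finset.filter_eq_self] using huniv
  choose m hm using hex
  obtain ⟨l, l', hne, heq⟩ := Fintype.exists_ne_map_eq_of_card_lt m (by simp)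
  have hzero : p - z (m l) = 0 :=
    eq_zero_of_inner_eq_zero_of_linearIndependent_pair (by simp) (hd l l' hne) (hm l)
      (heq ▸ hm l')
  exact hp ⟨m l, (sub_eq_zero.mp hzero).symm⟩
end

section
/- Let M ≥ 1, let z : Fin M → EuclideanSpace ℝ (Fin 3) be M points in space, and let d : Fin (2M+1) → EuclideanSpace ℝ (Fin 3) be observation directions such that for all pairwise distinct l₁, l₂, l₃ the triple (d l₁, d l₂, d l₃) is linearly independent over ℝ (no three directions are coplanar). Then for every p ∈ EuclideanSpace ℝ (Fin 3) with p ∉ Set.range z, the number of indices l : Fin (2M+1) for which there exists m : Fin M with ⟪d l, p − z m⟫ = 0 is at most 2M; that is, (Finset.univ.filter (fun l => ∃ m, ⟪d l, p − z m⟫ = 0)).card ≤ 2M. -/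
open scoped RealInnerProductSpace Classical

/-- A vector orthogonal to as many linearly independent vectors as the dimension vanishes. -/
theorem eq_zero_of_linearIndependent_of_inner_eq_zero {E ι : Type*} [NormedAddCommGroup E]
    [InnerProductSpace ℝ E] [Fintype ι] [FiniteDimensional ℝ E] {b : ι → E}
    (hb : LinearIndependent ℝ b) (hcard : Fintype.card ι = Module.finrank ℝ E) {v : E}
    (hv : ∀ i, ⟪b i, v⟫ = 0) : v = 0 := by
  have hspan : Submodule.span ℝ (Set.range b) = ⊤ :=
    hb.span_eq_top_of_card_eq_finrank' hcard
  have hmem : v ∈ Submodule.span ℝ (Set.range b) := hspan ▸ Submodule.mem_top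
  have horth : ∀ w ∈ Submodule.span ℝ (Set.range b), ⟪w, v⟫ = 0 := by
    intro w hw
    induction hw using Submodule.span_induction with
    | mem x hx => obtain ⟨i, rfl⟩ := hx; exact hv i
    | zero => exact inner_zero_left v
    | add x y _ _ hx hy => rw [inner_add_left, hx, hy, add_zero]
    | smul a x _ hx => rw [real_inner_smul_left, hx, mul_zero]
  exact inner_self_eq_zero.mp (horth v hmem)

/-- If no three of the directions are coplanar, at most two are orthogonal to a nonzero vector. -/
theorem card_filter_inner_eq_zero_le_two {ι : Type*} [Fintype ι]
    {d : ι → EuclideanSpace ℝ (Fin 3)}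
    (hd : ∀ l₁ l₂ l₃ : ι, l₁ ≠ l₂ → l₁ ≠ l₃ → l₂ ≠ l₃ →
      LinearIndependent ℝ ![d l₁, d l₂, d l₃])
    {v : EuclideanSpace ℝ (Fin 3)} (hv : v ≠ 0) :
    (Finset.univ.filter (fun l => ⟪d l, v⟫ = 0)).card ≤ 2 := by
  by_contra! h
  obtain ⟨a, b, c, ha, hb, hc, hab, hac, hbc⟩ := Finset.two_lt_card_iff.mp h
  simp only [Finset.mem_filter, Finset.mem_univ, true_and] at ha hb hc
  refine hv (eq_zero_of_linearIndependent_of_inner_eq_zero (hd a b c hab hac hbc) (by simp) ?_)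
  intro i
  fin_cases i
  exacts [ha, hb, hc]

theorem stmt_8 (M : ℕ) (hM : 1 ≤ M) (z : Fin M → EuclideanSpace ℝ (Fin 3))
    (d : Fin (2 * M + 1) → EuclideanSpace ℝ (Fin 3))
    (hd : ∀ l₁ l₂ l₃ : Fin (2 * M + 1), l₁ ≠ l₂ → l₁ ≠ l₃ → l₂ ≠ l₃ →
      LinearIndependent ℝ ![d l₁, d l₂, d l₃])
    (p : EuclideanSpace ℝ (Fin 3)) (hp : p ∉ Set.range z) :
    (Finset.univ.filter (fun l : Fin (2 * M + 1) => ∃ m : Fin M, ⟪d l, p - z m⟫ = 0)).card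
      ≤ 2 * M := by
  have hcover : Finset.univ.filter (fun l : Fin (2 * M + 1) => ∃ m : Fin M, ⟪d l, p - z m⟫ = 0)
      = Finset.univ.biUnion
        (fun m : Fin M => Finset.univ.filter (fun l => ⟪d l, p - z m⟫ = 0)) := by
    ext l
    simp
  rw [hcover]
  refine (Finset.card_biUnion_le_card_mul _ _ 2 fun m _ => ?_).trans (by simp [mul_comm])
  exact card_filter_inner_eq_zero_le_two hd (sub_ne_zero.mpr fun h => hp ⟨m, h.symm⟩)
end

section
/- Let M ≥ 1, let z, z' : Fin M → EuclideanSpace ℝ (Fin 3) be injective (the point sources in each configuration have pairwise distinct locations), let τ, τ' : Fin M → ℂ satisfy τ m ≠ 0 and τ' m ≠ 0 for all m, and let d : Fin (2M+1) → EuclideanSpace ℝ (Fin 3) be unit vectors (‖d l‖ = 1) such that for all pairwise distinct l₁, l₂, l₃ the triple (d l₁, d l₂, d l₃) is linearly independent over ℝ. If for every l : Fin (2M+1) and every k : ℝ one has ∑ m, τ m · exp(−I·k·⟪d l, z m⟫) = ∑ m, τ' m · exp(−I·k·⟪d l, z' m⟫), then there exists a permutation σ : Equiv.Perm (Fin M)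 such that z' m = z (σ m) and τ' m = τ (σ m) for all m. -/
open scoped RealInnerProductSpace

open Finset in
/-- If an exponential sum with real frequencies vanishes identically, the coefficients of each
frequency add up to zero. -/
theorem sum_filter_eq_zero_of_exp_sum_eq_zero {ι : Type*} [Fintype ι] (t : ι → ℝ) (w : ι → ℂ)
    (h : ∀ k : ℝ, ∑ i, w i * Complex.exp (-Complex.I * k * t i) = 0) (s : ℝ) :
    ∑ i with t i = s, w i = 0 := by
  let χ : ℝ → (Multiplicative ℝ →* ℂ) := fun s =>
    { toFun := fun k => Complex.exp (-Complex.I * (Multiplicative.toAdd k : ℝ) * s)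
      map_one' := by simp
      map_mul' := fun x y => by
        rw [← Complex.exp_add, toAdd_mul]
        push_cast
        ring_nf }
  have hχ : Function.Injective χ := by
    intro a b hab
    by_contra hne
    have hsub : (a : ℂ) - b ≠ 0 := by
      rw [sub_ne_zero]
      exact_mod_cast hne
    have h1 : Complex.exp (-Complex.I * ((Real.pi / (a - b) : ℝ) : ℂ) * a) =
        Complex.exp (-Complex.I * ((Real.pi / (a - b) : ℝ) : ℂ) * b) :=
      DFunLike.congr_fun hab (Multiplicative.ofAdd (Real.pi / (a - b)))
    have h2 : -Complex.I * ((Real.pi / (a - b) : ℝ) : ℂ) * b =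
        -Complex.I * ((Real.pi / (a - b) : ℝ) : ℂ) * a + Real.pi * Complex.I := by
      push_cast
      field_simp
      ring
    rw [h2, Complex.exp_add, Complex.exp_pi_mul_I] at h1
    have h3 := Complex.exp_ne_zero (-Complex.I * ((Real.pi / (a - b) : ℝ) : ℂ) * a)
    apply h3
    linear_combination (1 / 2 : ℂ) * h1
  have hli : LinearIndependent ℂ (fun s => (χ s : Multiplicative ℝ → ℂ)) :=
    (linearIndependent_monoidHom (Multiplicative ℝ) ℂ).comp χ hχ
  by_cases hs : s ∈ univ.image t
  · refine linearIndependent_iff'.1 hli (univ.image t) (fun s => ∑ i with t i = s, w i) ?_ s hs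
    funext k
    have hk := h (Multiplicative.toAdd k)
    rw [← sum_fiberwise_of_maps_to (g := t) (t := univ.image t)
      (fun i _ => mem_image_of_mem t (mem_univ i))] at hk
    rw [Finset.sum_apply, Pi.zero_apply, ← hk]
    refine sum_congr rfl fun r _ => ?_
    rw [Pi.smul_apply, smul_eq_mul, sum_mul]
    refine sum_congr rfl fun i hi => ?_
    rw [(mem_filter.1 hi).2]
    rfl
  · rw [filter_eq_empty_iff.2, sum_empty]
    rintro i - rfl
    exact hs (mem_image_of_mem t (mem_univ i))

/-- A vector of `ℝ³` orthogonal to three linearly independent vectors vanishes. -/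
theorem eq_zero_of_inner_eq_zero_of_linearIndependent (a b c v : EuclideanSpace ℝ (Fin 3))
    (h : LinearIndependent ℝ ![a, b, c]) (ha : ⟪a, v⟫ = 0) (hb : ⟪b, v⟫ = 0) (hc : ⟪c, v⟫ = 0) :
    v = 0 := by
  have hspan : Submodule.span ℝ (Set.range ![a, b, c]) = ⊤ :=
    h.span_eq_top_of_card_eq_finrank (by simp)
  have hv : v ∈ (Submodule.span ℝ (Set.range ![a, b, c]))ᗮ := by
    rw [Submodule.mem_orthogonal]
    intro u hu
    induction hu using Submodule.span_induction with
    | mem x hx =>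
      obtain ⟨i, rfl⟩ := hx
      fin_cases i <;> simpa
    | zero => simp
    | add x y _ _ hx hy => rw [inner_add_left, hx, hy, add_zero]
    | smul r x _ hx => rw [real_inner_smul_left, hx, mul_zero]
  rwa [hspan, Submodule.top_orthogonal_eq_bot, Submodule.mem_bot] at hv

open Finset in
/-- If a real weight has vanishing sums over all planes orthogonal to given directions, no three
of which are coplanar, then a point of positive weight forces at least half as many points of
negative weight as there are directions. -/
theorem card_le_two_mul_card_neg {κ : Type*} [Fintype κ] (d : κ → EuclideanSpace ℝ (Fin 3))
    (hd : ∀ l₁ l₂ l₃ : κ, l₁ ≠ l₂ → l₁ ≠ l₃ → l₂ ≠ l₃ →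
      LinearIndependent ℝ ![d l₁, d l₂, d l₃])
    (S : Finset (EuclideanSpace ℝ (Fin 3))) (g : EuclideanSpace ℝ (Fin 3) → ℝ)
    (h : ∀ l, ∀ s : ℝ, ∑ x ∈ S with ⟪d l, x⟫ = s, g x = 0)
    (a : EuclideanSpace ℝ (Fin 3)) (haS : a ∈ S) (ha : 0 < g a) :
    Fintype.card κ ≤ 2 * #{x ∈ S | g x < 0} := by
  classical
  have hex : ∀ l, ∃ b ∈ S.filter (fun x => g x < 0), ⟪d l, b⟫ = ⟪d l, a⟫ := by
    intro l
    by_contra! hno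
    have hnonneg : ∀ x ∈ S.filter (fun x => ⟪d l, x⟫ = ⟪d l, a⟫), 0 ≤ g x := by
      intro x hx
      rw [mem_filter] at hx
      by_contra! hneg
      exact hno x (mem_filter.2 ⟨hx.1, hneg⟩) hx.2
    exact ha.ne' ((sum_eq_zero_iff_of_nonneg hnonneg).1 (h l _) a (mem_filter.2 ⟨haS, rfl⟩))
  choose b hbS hb using hex
  by_contra! hlt
  obtain ⟨y, hy, hy2⟩ := exists_lt_card_fiber_of_mul_lt_card_of_maps_to (s := univ)
    (t := S.filter (fun x => g x < 0)) (f := b) (n := 2) (fun l _ => hbS l)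
    (by rw [card_univ]; omega)
  obtain ⟨l₁, h1, l₂, h2, l₃, h3, h12, h13, h23⟩ := two_lt_card.1 hy2
  have key : ∀ l ∈ univ.filter (fun l => b l = y), ⟪d l, y - a⟫ = 0 := by
    intro l hl
    rw [inner_sub_right, ← (mem_filter.1 hl).2, hb, sub_self]
  have hya : y = a := sub_eq_zero.1 (eq_zero_of_inner_eq_zero_of_linearIndependent _ _ _ _
    (hd l₁ l₂ l₃ h12 h13 h23) (key _ h1) (key _ h2) (key _ h3))
  have hneg := (mem_filter.1 hy).2
  rw [hya] at hneg
  exact lt_asymm ha hneg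

open Finset in
/-- A real weight on fewer points than there are directions, no three of them coplanar, vanishes
as soon as its sums over all planes orthogonal to these directions do. -/
theorem weight_eq_zero_of_plane_sums_eq_zero {κ : Type*} [Fintype κ]
    (d : κ → EuclideanSpace ℝ (Fin 3))
    (hd : ∀ l₁ l₂ l₃ : κ, l₁ ≠ l₂ → l₁ ≠ l₃ → l₂ ≠ l₃ →
      LinearIndependent ℝ ![d l₁, d l₂, d l₃])
    (S : Finset (EuclideanSpace ℝ (Fin 3))) (hS : #S < Fintype.card κ)
    (g : EuclideanSpace ℝ (Fin 3) → ℝ)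
    (h : ∀ l, ∀ s : ℝ, ∑ x ∈ S with ⟪d l, x⟫ = s, g x = 0) :
    ∀ x ∈ S, g x = 0 := by
  have hpos := card_le_two_mul_card_neg d hd S g h
  have hneg := card_le_two_mul_card_neg d hd S (fun x => - g x)
    (fun l s => by rw [sum_neg_distrib, h, neg_zero])
  simp only [Left.neg_neg_iff, Left.neg_pos_iff] at hneg
  have hcard : #{x ∈ S | g x < 0} + #{x ∈ S | 0 < g x} ≤ #S := by
    rw [← card_union_of_disjoint (disjoint_filter.2 fun x _ h1 h2 => lt_asymm h1 h2)]
    exact card_le_card (union_subset (filter_subset _ _) (filter_subset _ _))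
  intro x hx
  by_contra hne
  rcases lt_or_gt_of_ne hne with hlt | hgt
  · have h1 := hneg x hx hlt
    obtain ⟨y, hy⟩ : ({y ∈ S | 0 < g y}).Nonempty := card_pos.1 (by omega)
    have h2 := hpos y (mem_filter.1 hy).1 (mem_filter.1 hy).2
    omega
  · have h1 := hpos x hx hgt
    obtain ⟨y, hy⟩ : ({y ∈ S | g y < 0}).Nonempty := card_pos.1 (by omega)
    have h2 := hneg y (mem_filter.1 hy).1 (mem_filter.1 hy).2
    omega

open Finset in
/-- Fewer point masses than directions, no three of them coplanar, cancel at every point as soon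
as they cancel on every plane orthogonal to one of the directions. -/
theorem sum_filter_eq_zero_of_plane_sums_eq_zero {ι κ : Type*} [Fintype ι] [Fintype κ]
    (hcard : Fintype.card ι < Fintype.card κ) (d : κ → EuclideanSpace ℝ (Fin 3))
    (hd : ∀ l₁ l₂ l₃ : κ, l₁ ≠ l₂ → l₁ ≠ l₃ → l₂ ≠ l₃ →
      LinearIndependent ℝ ![d l₁, d l₂, d l₃])
    (p : ι → EuclideanSpace ℝ (Fin 3)) (w : ι → ℝ)
    (h : ∀ l, ∀ s : ℝ, ∑ i with ⟪d l, p i⟫ = s, w i = 0) (x : EuclideanSpace ℝ (Fin 3)) :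
    ∑ i with p i = x, w i = 0 := by
  classical
  by_cases hx : x ∈ univ.image p
  · refine weight_eq_zero_of_plane_sums_eq_zero d hd (univ.image p)
      (card_image_le.trans_lt (by rwa [card_univ])) (fun x => ∑ i with p i = x, w i) ?_ x hx
    intro l s
    rw [← h l s, ← sum_fiberwise_of_maps_to (g := p)
      (t := (univ.image p).filter (fun x => ⟪d l, x⟫ = s))
      (fun i hi => mem_filter.2 ⟨mem_image_of_mem p (mem_univ i), (mem_filter.1 hi).2⟩)]
    refine sum_congr rfl fun y hy => ?_
    rw [filter_filter]
    refine sum_congr (filter_congr fun i _ => ?_) fun _ _ => rfl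
    constructor
    · rintro rfl
      exact ⟨(mem_filter.1 hy).2, rfl⟩
    · exact fun hi => hi.2
  · rw [filter_eq_empty_iff.2, sum_empty]
    rintro i - rfl
    exact hx (mem_image_of_mem p (mem_univ i))

theorem stmt_9 (M : ℕ) (hM : 1 ≤ M) (z z' : Fin M → EuclideanSpace ℝ (Fin 3))
    (hz : Function.Injective z) (hz' : Function.Injective z')
    (τ τ' : Fin M → ℂ) (hτ : ∀ m, τ m ≠ 0) (hτ' : ∀ m, τ' m ≠ 0)
    (d : Fin (2 * M + 1) → EuclideanSpace ℝ (Fin 3)) (hdu : ∀ l, ‖d l‖ = 1)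
    (hd : ∀ l₁ l₂ l₃ : Fin (2 * M + 1), l₁ ≠ l₂ → l₁ ≠ l₃ → l₂ ≠ l₃ →
      LinearIndependent ℝ ![d l₁, d l₂, d l₃])
    (h : ∀ l : Fin (2 * M + 1), ∀ k : ℝ,
      ∑ m, τ m * Complex.exp (-Complex.I * k * ⟪d l, z m⟫) =
      ∑ m, τ' m * Complex.exp (-Complex.I * k * ⟪d l, z' m⟫)) :
    ∃ σ : Equiv.Perm (Fin M), ∀ m, z' m = z (σ m) ∧ τ' m = τ (σ m) := by
  classical
  let p : Fin M ⊕ Fin M → EuclideanSpace ℝ (Fin 3) := Sum.elim z z'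
  let w : Fin M ⊕ Fin M → ℂ := Sum.elim τ (fun m => - τ' m)
  have hplane : ∀ l, ∀ s : ℝ, ∑ i with ⟪d l, p i⟫ = s, w i = 0 := by
    intro l s
    refine sum_filter_eq_zero_of_exp_sum_eq_zero (fun i => ⟪d l, p i⟫) w (fun k => ?_) s
    simp only [Fintype.sum_sum_type, p, w, Sum.elim_inl, Sum.elim_inr, neg_mul (τ' _),
      Finset.sum_neg_distrib, h l k, add_neg_cancel]
  have hcard : Fintype.card (Fin M ⊕ Fin M) < Fintype.card (Fin (2 * M + 1)) := by
    simp only [Fintype.card_sum, Fintype.card_fin]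
    omega
  have hpoint : ∀ x, ∑ i with p i = x, w i = 0 := by
    intro x
    apply Complex.ext
    · rw [Complex.re_sum]
      exact sum_filter_eq_zero_of_plane_sums_eq_zero hcard d hd p (fun i => (w i).re)
        (fun l s => by rw [← Complex.re_sum, hplane, Complex.zero_re]) x
    · rw [Complex.im_sum]
      exact sum_filter_eq_zero_of_plane_sums_eq_zero hcard d hd p (fun i => (w i).im)
        (fun l s => by rw [← Complex.im_sum, hplane, Complex.zero_im]) x
  have hmatch : ∀ m, ∃ j, z' m = z j ∧ τ' m = τ j := by
    intro m
    have hm := hpoint (z' m)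
    simp only [Finset.sum_filter, Fintype.sum_sum_type, p, w, Sum.elim_inl, Sum.elim_inr,
      hz'.eq_iff, Finset.sum_ite_eq', Finset.mem_univ, if_true] at hm
    by_cases hj : ∃ j, z j = z' m
    · obtain ⟨j, hj⟩ := hj
      simp only [← hj, hz.eq_iff, Finset.sum_ite_eq', Finset.mem_univ, if_true] at hm
      exact ⟨j, hj.symm, by linear_combination -hm⟩
    · push Not at hj
      simp only [hj, if_false, Finset.sum_const_zero, zero_add, neg_eq_zero] at hm
      exact absurd hm (hτ' m)
  choose σ hσz hσ using hmatch
  have hinj : Function.Injective σ := fun a b hab => hz' (by rw [hσz, hσz, hab])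
  exact ⟨Equiv.ofBijective σ (Finite.injective_iff_bijective.1 hinj), fun m => ⟨hσz m, hσ m⟩⟩
end

section
/- Let M ≥ 1, let z, z' : Fin M → EuclideanSpace ℝ (Fin 2) be injective (the point sources in each configuration have pairwise distinct locations), let τ, τ' : Fin M → ℂ satisfy τ m ≠ 0 and τ' m ≠ 0 for all m, and let d : Fin (M+1) → EuclideanSpace ℝ (Fin 2) be unit vectors (‖d l‖ = 1) such that for all l ≠ l' the pair (d l, d l') is linearly independent over ℝ. If for every l : Fin (M+1) and every k : ℝ one has ∑ m, τ m · exp(−I·k·⟪d l, z m⟫) = ∑ m, τ' m · exp(−I·k·⟪d l, z' m⟫), then there exists a permutation σ : Equiv.Perm (Fin M) such that z' m = z (σ m) and τ' m = τ (σ m) for all m. -/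
open scoped RealInnerProductSpace

/-- The characters `k ↦ exp (-i k t)` of the additive group `ℝ`. -/
noncomputable def expChar (t : ℝ) : Multiplicative ℝ →* ℂ where
  toFun k := Complex.exp (-Complex.I * (Multiplicative.toAdd k : ℝ) * t)
  map_one' := by simp
  map_mul' a b := by
    rw [← Complex.exp_add]
    congr 1
    push_cast [toAdd_mul]
    ring

theorem expChar_injective : Function.Injective expChar := by
  intro s t hst
  have hfun : (fun k : ℝ => Complex.exp (-Complex.I * k * s)) =
      fun k : ℝ => Complex.exp (-Complex.I * k * t) :=
    funext fun k => DFunLike.congr_fun hst (Multiplicative.ofAdd k)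
  have hderiv (r : ℝ) : HasDerivAt (fun k : ℝ => Complex.exp (-Complex.I * k * r))
      (-Complex.I * r) 0 := by
    have h1 : HasDerivAt (fun k : ℝ => -Complex.I * (k : ℂ) * r) (-Complex.I * 1 * r) 0 :=
      (Complex.ofRealCLM.hasDerivAt.const_mul (-Complex.I)).mul_const (r : ℂ)
    simpa using h1.cexp
  have h2 := (hderiv s).unique (hfun ▸ hderiv t)
  simpa using h2

theorem linearIndependent_expChar :
    LinearIndependent ℂ (fun t : ℝ => (expChar t : Multiplicative ℝ → ℂ)) :=
  (linearIndependent_monoidHom (Multiplicative ℝ) ℂ).comp expChar expChar_injective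

/-- If the push-forward of a finitely supported weight along `f` vanishes, then no fibre of `f`
meets the support in exactly one point. -/
theorem Finsupp.exists_ne_of_mapDomain_eq_zero {α β R : Type*} [AddCommMonoid R]
    (f : α → β) (c : α →₀ R) (h : c.mapDomain f = 0) {p : α} (hp : p ∈ c.support) :
    ∃ q ∈ c.support, q ≠ p ∧ f q = f p := by
  classical
  by_contra! hcon
  have h1 : c.mapDomain f (f p) = 0 := by rw [h]; rfl
  rw [Finsupp.mapDomain, Finsupp.sum_apply, Finsupp.sum,
    Finset.sum_eq_single_of_mem p hp fun q hq hqp => Finsupp.single_eq_of_ne (hcon q hq hqp).symm,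
    Finsupp.single_eq_same] at h1
  exact Finsupp.mem_support_iff.mp hp h1

theorem EuclideanSpace.real_inner_fin_two (x y : EuclideanSpace ℝ (Fin 2)) :
    ⟪x, y⟫ = x 0 * y 0 + x 1 * y 1 := by
  simp [PiLp.inner_apply, Fin.sum_univ_two, mul_comm]

/-- In a finite planar set whose points are never alone on the lines orthogonal to `u`, there is
an edge of the convex hull with outer normal `u`; `p` is its counterclockwise end. -/
theorem exists_supporting_edge (S : Finset (EuclideanSpace ℝ (Fin 2))) (hS : S.Nonempty)
    (u : EuclideanSpace ℝ (Fin 2)) (hu : ‖u‖ = 1)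
    (hfib : ∀ p ∈ S, ∃ q ∈ S, q ≠ p ∧ ⟪u, q⟫ = ⟪u, p⟫) :
    ∃ p ∈ S, (∀ x ∈ S, ⟪u, x⟫ ≤ ⟪u, p⟫) ∧
      (∀ x ∈ S, ⟪u, x⟫ = ⟪u, p⟫ → u 0 * x 1 - u 1 * x 0 ≤ u 0 * p 1 - u 1 * p 0) ∧
      ∃ q ∈ S, ∃ a : ℝ, 0 < a ∧ q 0 - p 0 = a * u 1 ∧ q 1 - p 1 = -(a * u 0) := by
  obtain ⟨r, hr, hrmax⟩ := S.exists_max_image (fun x => ⟪u, x⟫) hS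
  obtain ⟨p, hp, hpmax⟩ := (S.filter fun x => ⟪u, x⟫ = ⟪u, r⟫).exists_max_image
    (fun x => u 0 * x 1 - u 1 * x 0) ⟨r, by simp [hr]⟩
  rw [Finset.mem_filter] at hp
  have hface : ∀ x ∈ S, ⟪u, x⟫ = ⟪u, p⟫ →
      u 0 * x 1 - u 1 * x 0 ≤ u 0 * p 1 - u 1 * p 0 := fun x hx hxp =>
    hpmax x (Finset.mem_filter.mpr ⟨hx, hxp.trans hp.2⟩)
  obtain ⟨q, hq, hqp, hqu⟩ := hfib p hp.1
  have hle := hface q hq hqu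
  have hu2 : u 0 * u 0 + u 1 * u 1 = 1 := by
    rw [← EuclideanSpace.real_inner_fin_two, real_inner_self_eq_norm_sq, hu, one_pow]
  rw [EuclideanSpace.real_inner_fin_two, EuclideanSpace.real_inner_fin_two] at hqu
  have e0 : q 0 - p 0 = (u 1 * (q 0 - p 0) - u 0 * (q 1 - p 1)) * u 1 := by
    linear_combination (-(q 0 - p 0)) * hu2 + u 0 * hqu
  have e1 : q 1 - p 1 = -((u 1 * (q 0 - p 0) - u 0 * (q 1 - p 1)) * u 0) := by
    linear_combination (-(q 1 - p 1)) * hu2 + u 1 * hqu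
  refine ⟨p, hp.1, fun x hx => (hrmax x hx).trans_eq hp.2.symm, hface, q, hq, _, ?_, e0, e1⟩
  refine lt_of_le_of_ne (by linarith) fun h0 => hqp ?_
  rw [← h0] at e0 e1
  ext i
  fin_cases i
  · simpa [sub_eq_zero] using e0
  · simpa [sub_eq_zero] using e1

/-- A convex polygon has at least as many vertices as it has distinct edge normals. -/
theorem card_le_card_of_fibres {ι : Type*} [Fintype ι] (S : Finset (EuclideanSpace ℝ (Fin 2)))
    (hS : S.Nonempty) (u : ι → EuclideanSpace ℝ (Fin 2)) (hu : ∀ i, ‖u i‖ = 1)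
    (hinj : Function.Injective u)
    (hfib : ∀ i, ∀ p ∈ S, ∃ q ∈ S, q ≠ p ∧ ⟪u i, q⟫ = ⟪u i, p⟫) :
    Fintype.card ι ≤ S.card := by
  choose p hp hmax hface q hq a ha hq0 hq1 using
    fun i => exists_supporting_edge S hS (u i) (hu i) (hfib i)
  have hu2 (i) : u i 0 * u i 0 + u i 1 * u i 1 = 1 := by
    rw [← EuclideanSpace.real_inner_fin_two, real_inner_self_eq_norm_sq, hu, one_pow]
  refine Finset.card_le_card_of_injOn p (fun i _ => hp i) fun i _ j _ hij => hinj ?_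
  have key (i j) (hij : p i = p j) : u i 0 * u j 1 - u i 1 * u j 0 ≤ 0 := by
    have h1 := hmax i (q j) (hq j)
    rw [hij, EuclideanSpace.real_inner_fin_two, EuclideanSpace.real_inner_fin_two] at h1
    have h2 : a j * (u i 0 * u j 1 - u i 1 * u j 0) ≤ 0 := by
      linear_combination h1 - u i 0 * hq0 j - u i 1 * hq1 j
    exact nonpos_of_mul_nonpos_right h2 (ha j)
  have hcross : u i 0 * u j 1 - u i 1 * u j 0 = 0 :=
    le_antisymm (key i j hij) (by linarith [key j i hij.symm])
  have hpos : 0 ≤ u i 0 * u j 0 + u i 1 * u j 1 := by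
    have h1 := hface i (q j) (hq j) (by
      rw [hij, EuclideanSpace.real_inner_fin_two, EuclideanSpace.real_inner_fin_two]
      linear_combination u i 0 * hq0 j + u i 1 * hq1 j + a j * hcross)
    rw [hij] at h1
    have h2 : 0 ≤ a j * (u i 0 * u j 0 + u i 1 * u j 1) := by
      linear_combination h1 - u i 0 * hq1 j + u i 1 * hq0 j
    exact nonneg_of_mul_nonneg_right h2 (ha j)
  have hone : u i 0 * u j 0 + u i 1 * u j 1 = 1 := by
    have hsq : (u i 0 * u j 0 + u i 1 * u j 1) ^ 2 = 1 := by
      linear_combination (u j 0 * u j 0 + u j 1 * u j 1) * hu2 i + hu2 j -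
        (u i 0 * u j 1 - u i 1 * u j 0) * hcross
    nlinarith
  refine (inner_eq_one_iff_of_norm_eq_one (𝕜 := ℝ) (hu i) (hu j)).mp ?_
  rw [EuclideanSpace.real_inner_fin_two, hone]

theorem stmt_10 (M : ℕ) (hM : 1 ≤ M) (z z' : Fin M → EuclideanSpace ℝ (Fin 2))
    (hz : Function.Injective z) (hz' : Function.Injective z')
    (τ τ' : Fin M → ℂ) (hτ : ∀ m, τ m ≠ 0) (hτ' : ∀ m, τ' m ≠ 0)
    (d : Fin (M + 1) → EuclideanSpace ℝ (Fin 2)) (hdu : ∀ l, ‖d l‖ = 1)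
    (hd : ∀ l l' : Fin (M + 1), l ≠ l' → LinearIndependent ℝ ![d l, d l'])
    (h : ∀ l : Fin (M + 1), ∀ k : ℝ,
      ∑ m, τ m * Complex.exp (-Complex.I * k * ⟪d l, z m⟫) =
      ∑ m, τ' m * Complex.exp (-Complex.I * k * ⟪d l, z' m⟫)) :
    ∃ σ : Equiv.Perm (Fin M), ∀ m, z' m = z (σ m) ∧ τ' m = τ (σ m) := by
  classical
  set c : EuclideanSpace ℝ (Fin 2) →₀ ℂ :=
    ∑ m, Finsupp.single (z m) (τ m) - ∑ m, Finsupp.single (z' m) (τ' m) with hc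
  have hproj (l) : c.mapDomain (fun x => ⟪d l, x⟫) = 0 := by
    refine linearIndependent_iff.mp linearIndependent_expChar _ ?_
    rw [Finsupp.linearCombination_mapDomain, hc, map_sub, map_sum, map_sum, sub_eq_zero]
    funext k
    simpa [Finsupp.linearCombination_single, Finset.sum_apply, expChar] using
      h l (Multiplicative.toAdd k)
  have hcard : c.support.card ≤ 2 * M := by
    have hsub : c.support ⊆ Finset.univ.image z ∪ Finset.univ.image z' := by
      intro x hx
      by_contra hx'
      simp only [Finset.mem_union, Finset.mem_image, Finset.mem_univ, true_and, not_or,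
        not_exists] at hx'
      refine Finsupp.mem_support_iff.mp hx ?_
      simp [hc, hx'.1, hx'.2]
    refine (Finset.card_le_card hsub).trans ((Finset.card_union_le _ _).trans ?_)
    have h1 := Finset.card_image_le (s := Finset.univ) (f := z)
    have h2 := Finset.card_image_le (s := Finset.univ) (f := z')
    simp only [Finset.card_univ, Fintype.card_fin] at h1 h2
    omega
  have hc0 : c = 0 := by
    by_contra hne
    have hcomb := card_le_card_of_fibres c.support (Finsupp.support_nonempty_iff.mpr hne)
      (Sum.elim d fun l => -d l) (by rintro (l | l) <;> simp [hdu]) ?_ ?_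
    · simp only [Fintype.card_sum, Fintype.card_fin] at hcomb
      omega
    · have hdep (s t : ℝ) (ht : t ≠ 0) (l l') (hll : s • d l + t • d l' = 0) : l = l' := by
        by_contra hne'
        exact ht (LinearIndependent.pair_iff.mp (hd l l' hne') s t hll).2
      have hself (l) : d l ≠ -d l := fun hl => by
        have h0 := congrArg (fun x => ⟪d l, x⟫) hl
        simp only [inner_neg_right, real_inner_self_eq_norm_sq, hdu] at h0
        norm_num at h0
      rintro (l | l) (l' | l') hll <;> simp only [Sum.elim_inl, Sum.elim_inr] at hll
      · rw [hdep 1 (-1) (by norm_num) l l' (by simp [hll])]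
      · obtain rfl := hdep 1 1 one_ne_zero l l' (by simp [hll])
        exact (hself l hll).elim
      · obtain rfl := hdep 1 1 one_ne_zero l l' (by simp [← hll])
        exact (hself l hll.symm).elim
      · rw [hdep 1 (-1) (by norm_num) l l' (by simp [neg_injective hll])]
    · rintro (l | l) p hp
      · exact Finsupp.exists_ne_of_mapDomain_eq_zero _ c (hproj l) hp
      · simpa using Finsupp.exists_ne_of_mapDomain_eq_zero _ c (hproj l) hp
  have hval (x) : ∑ n, (if z n = x then τ n else 0) = ∑ n, if z' n = x then τ' n else 0 := by
    have := DFunLike.congr_fun (sub_eq_zero.mp (hc.symm.trans hc0)) x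
    simpa [Finsupp.finsetSum_apply, Finsupp.single_apply] using this
  have hval' (m) : ∑ n, (if z n = z' m then τ n else 0) = τ' m := by
    simpa [hz'.eq_iff] using hval (z' m)
  have hex (m) : ∃ n, z n = z' m := by
    by_contra! hcon
    exact hτ' m (by simpa [hcon] using (hval' m).symm)
  choose σ hσ using hex
  have hσinj : Function.Injective σ := fun m m' hmm => hz' (by rw [← hσ m, ← hσ m', hmm])
  refine ⟨Equiv.ofBijective σ (Finite.injective_iff_bijective.mp hσinj), fun m => ?_⟩
  refine ⟨(hσ m).symm, ?_⟩
  simpa [← hσ m, hz.eq_iff] using (hval' m).symm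
end

section
/- Let M ≥ 1, let a : Fin M → ℝ, let τ : Fin M → ℂ, and let m₀ : Fin M be such that a m ≠ a m₀ for all m ≠ m₀. Then the function K ↦ (1/(2K)) · ∫ k in 0..K, ∑ m, τ m · (exp(−I·k·(a m − a m₀)) + exp(I·k·(a m − a m₀))) tends to τ m₀ as K → ∞ (i.e., Filter.Tendsto along Filter.atTop to the neighborhood of τ m₀). -/
/-- The mean over `[0, K]` of a nonconstant character of `ℝ` vanishes as `K → ∞`. -/
theorem tendsto_mean_exp_mul_I {b : ℝ} (hb : b ≠ 0) :
    Filter.Tendsto (fun K : ℝ => (1 / (2 * (K : ℂ))) *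
      ∫ k in (0 : ℝ)..K, Complex.exp ((b * Complex.I) * k)) Filter.atTop (nhds 0) := by
  have hc : (b * Complex.I : ℂ) ≠ 0 := by simp [hb]
  apply squeeze_zero_norm' (a := fun K : ℝ => |b|⁻¹ * K⁻¹)
  · filter_upwards [Filter.eventually_gt_atTop (0 : ℝ)] with K hK
    have h : ‖Complex.exp (b * Complex.I * K) - Complex.exp (b * Complex.I * (0 : ℝ))‖ ≤ 2 := by
      refine (norm_sub_le _ _).trans ?_
      have : (b * Complex.I * K : ℂ) = ((b * K : ℝ) : ℂ) * Complex.I := by push_cast; ring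
      rw [this, Complex.norm_exp_ofReal_mul_I]
      norm_num
    rw [integral_exp_mul_complex hc, norm_mul, norm_div, norm_div]
    simp only [norm_mul, norm_one, Complex.norm_real, Complex.norm_I, mul_one, Complex.norm_ofNat,
      Real.norm_eq_abs, abs_of_pos hK]
    have hb' := abs_pos.mpr hb
    calc _ ≤ 1 / (2 * K) * (2 / |b|) := by gcongr
      _ = _ := by field_simp
  · simpa using tendsto_inv_atTop_zero.const_mul |b|⁻¹

theorem tendsto_mean_exp_add_exp_neg {b : ℝ} (hb : b ≠ 0) :
    Filter.Tendsto (fun K : ℝ => (1 / (2 * (K : ℂ))) * ∫ k in (0 : ℝ)..K,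
      (Complex.exp (-Complex.I * k * b) + Complex.exp (Complex.I * k * b)))
      Filter.atTop (nhds 0) := by
  have h := (tendsto_mean_exp_mul_I (neg_ne_zero.mpr hb)).add (tendsto_mean_exp_mul_I hb)
  rw [add_zero] at h
  refine h.congr fun K => ?_
  rw [← mul_add, ← intervalIntegral.integral_add
    (Continuous.intervalIntegrable (by fun_prop) _ _)
    (Continuous.intervalIntegrable (by fun_prop) _ _)]
  congr 2
  funext k
  congr 2 <;> push_cast <;> ring

theorem stmt_11 (M : ℕ) (hM : 1 ≤ M) (a : Fin M → ℝ) (τ : Fin M → ℂ) (m₀ : Fin M)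
    (ha : ∀ m : Fin M, m ≠ m₀ → a m ≠ a m₀) :
    Filter.Tendsto (fun K : ℝ => (1 / (2 * (K : ℂ))) * ∫ k in (0:ℝ)..K,
        ∑ m, τ m * (Complex.exp (-Complex.I * k * ((a m : ℂ) - (a m₀ : ℂ))) +
          Complex.exp (Complex.I * k * ((a m : ℂ) - (a m₀ : ℂ)))))
      Filter.atTop (nhds (τ m₀)) := by
  have key : ∀ m ∈ Finset.univ, Filter.Tendsto (fun K : ℝ => τ m * ((1 / (2 * (K : ℂ))) *
      ∫ k in (0:ℝ)..K, (Complex.exp (-Complex.I * k * ((a m : ℂ) - (a m₀ : ℂ))) +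
          Complex.exp (Complex.I * k * ((a m : ℂ) - (a m₀ : ℂ))))))
      Filter.atTop (nhds (if m = m₀ then τ m else 0)) := by
    intro m _
    split_ifs with h
    · subst h
      refine tendsto_const_nhds.congr' ?_
      filter_upwards [Filter.eventually_gt_atTop (0 : ℝ)] with K hK
      have hK' : (K : ℂ) ≠ 0 := by exact_mod_cast hK.ne'
      simp only [sub_self, mul_zero, Complex.exp_zero, intervalIntegral.integral_const, sub_zero,
        Complex.real_smul]
      field_simp
      norm_num
    · simpa using (tendsto_mean_exp_add_exp_neg (sub_ne_zero.mpr (ha m h))).const_mul (τ m)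
  have hsum := tendsto_finsetSum Finset.univ key
  rw [Finset.sum_ite_eq' Finset.univ m₀ τ, if_pos (Finset.mem_univ m₀)] at hsum
  refine hsum.congr fun K => ?_
  rw [intervalIntegral.integral_finsetSum
    fun m _ => Continuous.intervalIntegrable (by fun_prop) _ _, Finset.mul_sum]
  refine Finset.sum_congr rfl fun m _ => ?_
  rw [intervalIntegral.integral_const_mul]
  ring
end

section
/- Let N, P, Q be natural numbers with P ≥ N and Q ≥ N, let ξ : Fin N → ℂ be pairwise distinct with ξ m ≠ 0 for all m, and let τ : Fin N → ℂ with τ m ≠ 0 for all m. Define the Hankel matrix U : Matrix (Fin P) (Fin Q) ℂ by U p q = ∑ m, τ m · (ξ m)^(p + q + 1) (indices p, q regarded as natural numbers starting from 0). Then the rank of U equals N. -/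
open scoped Matrix

open Matrix in
/-- A Hankel matrix of exponential sums is a diagonal matrix between two Vandermonde factors. -/
theorem hankel_eq_mul_diagonal_mul {R ι : Type*} [CommSemiring R] [Fintype ι] [DecidableEq ι]
    (P Q : ℕ) (ξ τ : ι → R) :
    (of fun (p : Fin P) (q : Fin Q) => ∑ m, τ m * ξ m ^ ((p : ℕ) + (q : ℕ) + 1)) =
      (of fun (p : Fin P) m => ξ m ^ (p : ℕ)) * diagonal (fun m => τ m * ξ m) *
        of fun m (q : Fin Q) => ξ m ^ (q : ℕ) := by
  ext p q
  rw [mul_apply]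
  simp only [of_apply, mul_diagonal]
  exact Finset.sum_congr rfl fun m _ => by ring

theorem stmt_14 (N P Q : ℕ) (hP : P ≥ N) (hQ : Q ≥ N)
    (ξ : Fin N → ℂ) (hξ : Function.Injective ξ) (hξ0 : ∀ m, ξ m ≠ 0)
    (τ : Fin N → ℂ) (hτ : ∀ m, τ m ≠ 0)
    (U : Matrix (Fin P) (Fin Q) ℂ)
    (hU : ∀ (p : Fin P) (q : Fin Q), U p q = ∑ m, τ m * ξ m ^ ((p : ℕ) + (q : ℕ) + 1)) :
    U.rank = N := by
  have hV : (Matrix.vandermonde ξ).det ≠ 0 := Matrix.det_vandermonde_ne_zero_iff.mpr hξ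
  have hUeq := (Matrix.ext hU : U = Matrix.of _).trans (hankel_eq_mul_diagonal_mul P Q ξ τ)
  apply le_antisymm
  · rw [hUeq]
    exact (Matrix.rank_mul_le_right _ _).trans (Matrix.rank_le_height _)
  · have hsub : U.submatrix (Fin.castLE hP) (Fin.castLE hQ) =
        (Matrix.vandermonde ξ)ᵀ * Matrix.diagonal (fun m => τ m * ξ m) *
          Matrix.vandermonde ξ := by
      rw [hUeq]
      rfl
    have hunit : IsUnit (U.submatrix (Fin.castLE hP) (Fin.castLE hQ)) := by
      rw [hsub, Matrix.isUnit_iff_isUnit_det, isUnit_iff_ne_zero, Matrix.det_mul,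
        Matrix.det_mul, Matrix.det_transpose, Matrix.det_diagonal]
      exact mul_ne_zero (mul_ne_zero hV
        (Finset.prod_ne_zero_iff.mpr fun m _ => mul_ne_zero (hτ m) (hξ0 m))) hV
    have hrank := (Matrix.rank_of_isUnit _ hunit).trans (Fintype.card_fin N)
    exact hrank.symm.trans_le (U.rank_submatrix_le (Fin.castLE hP) (Fin.castLE hQ))
end

section
/- Let N, P, Q be natural numbers with Q ≥ N, let ξ : Fin N → ℂ be pairwise distinct with ξ m ≠ 0 for all m, and let τ : Fin N → ℂ with τ m ≠ 0 for all m. Define the Hankel matrix U : Matrix (Fin P) (Fin Q) ℂ by U p q = ∑ m, τ m · (ξ m)^(p + q + 1) and the Vandermonde matrix V_P : Matrix (Fin P) (Fin N) ℂ by (V_P) p m = (ξ m)^(p : ℕ). Then the column spaces coincide: LinearMap.range (Matrix.mulVecLin U) = LinearMap.range (Matrix.mulVecLin V_P). -/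
/-- A rectangular Vandermonde matrix with distinct nodes and at least as many columns as rows
has full row rank. -/
theorem exists_sum_pow_mul_eq {K : Type*} [Field K] {N Q : ℕ} (hQ : N ≤ Q) {ξ : Fin N → K}
    (hξ : Function.Injective ξ) (y : Fin N → K) :
    ∃ x : Fin Q → K, ∀ m, ∑ q : Fin Q, ξ m ^ (q : ℕ) * x q = y m := by
  obtain ⟨k, rfl⟩ := Nat.exists_eq_add_of_le hQ
  have hV : IsUnit (Matrix.vandermonde ξ) :=
    (Matrix.isUnit_iff_isUnit_det _).2 (Matrix.det_vandermonde_ne_zero_iff.2 hξ).isUnit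
  obtain ⟨c, hc⟩ := Matrix.mulVec_surjective_iff_isUnit.2 hV y
  refine ⟨Fin.append c 0, fun m => ?_⟩
  simpa [Fin.sum_univ_add, Matrix.mulVec, dotProduct] using congrFun hc m

theorem stmt_15 (N P Q : ℕ) (hQ : Q ≥ N)
    (ξ : Fin N → ℂ) (hξ : Function.Injective ξ) (hξ0 : ∀ m, ξ m ≠ 0)
    (τ : Fin N → ℂ) (hτ : ∀ m, τ m ≠ 0)
    (U : Matrix (Fin P) (Fin Q) ℂ)
    (hU : ∀ (p : Fin P) (q : Fin Q), U p q = ∑ m, τ m * ξ m ^ ((p : ℕ) + (q : ℕ) + 1))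
    (VP : Matrix (Fin P) (Fin N) ℂ) (hVP : ∀ (p : Fin P) (m : Fin N), VP p m = ξ m ^ (p : ℕ)) :
    LinearMap.range U.mulVecLin = LinearMap.range VP.mulVecLin := by
  have hfac : U = VP * Matrix.of fun (m : Fin N) (q : Fin Q) => τ m * ξ m * ξ m ^ (q : ℕ) := by
    ext p q
    simp only [hU, hVP, Matrix.mul_apply, Matrix.of_apply]
    exact Finset.sum_congr rfl fun m _ => by ring
  rw [hfac, Matrix.mulVecLin_mul]
  refine LinearMap.range_comp_of_range_eq_top _ (LinearMap.range_eq_top.2 fun y => ?_)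
  obtain ⟨x, hx⟩ := exists_sum_pow_mul_eq hQ hξ fun m => y m / (τ m * ξ m)
  refine ⟨x, funext fun m => ?_⟩
  have hne : τ m * ξ m ≠ 0 := mul_ne_zero (hτ m) (hξ0 m)
  simp only [Matrix.mulVecLin_apply, Matrix.mulVec, dotProduct, Matrix.of_apply, mul_assoc _ (ξ m ^ _)]
  rw [← Finset.mul_sum, hx, mul_div_cancel₀ _ hne]
end

section
/- Let N, P, Q be natural numbers with P ≥ N + 1 and Q ≥ N, let ξ : Fin N → ℂ be pairwise distinct with ξ m ≠ 0 for all m, and let τ : Fin N → ℂ with τ m ≠ 0 for all m. Define the Hankel matrix U : Matrix (Fin P) (Fin Q) ℂ by U p q = ∑ m, τ m · (ξ m)^(p + q + 1). For ξ₀ ∈ ℂ define φ : Fin P → ℂ by φ p = ξ₀^(p : ℕ). Then φ ∈ LinearMap.range (Matrix.mulVecLin U) if and only if there exists m : Fin N with ξ₀ = ξ m. -/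
open Polynomial in
/-- A polynomial of degree less than `n` is evaluated by a sum over `Fin n`. -/
theorem eval_eq_sum_fin_of_natDegree_lt {R : Type*} [Semiring R] {f : R[X]} {n : ℕ}
    (hf : f.natDegree < n) (x : R) :
    f.eval x = ∑ i : Fin n, f.coeff i * x ^ (i : ℕ) := by
  rw [Polynomial.eval_eq_sum_range' hf, ← Fin.sum_univ_eq_sum_range (fun i => f.coeff i * x ^ i)]

open Polynomial in
/-- A truncated geometric sequence that is a linear combination of fewer truncated geometric
sequences than its length has the same ratio as one of them. -/
theorem exists_eq_of_pow_eq_sum {K : Type*} [Field K] {N P : ℕ} (hP : N + 1 ≤ P)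
    (ξ c : Fin N → K) (x : K) (h : ∀ p : Fin P, x ^ (p : ℕ) = ∑ m, c m * ξ m ^ (p : ℕ)) :
    ∃ m, x = ξ m := by
  set f : K[X] := ∏ m, (X - C (ξ m)) with hf
  have hdeg : f.natDegree < P := by
    rw [hf, Polynomial.natDegree_prod_of_monic _ _ fun m _ => monic_X_sub_C (ξ m)]
    simpa using hP
  have hroot (m : Fin N) : f.eval (ξ m) = 0 := by
    rw [hf, Polynomial.eval_prod]
    exact Finset.prod_eq_zero (Finset.mem_univ m) (by simp)
  have hx : f.eval x = 0 := by
    calc f.eval x = ∑ p : Fin P, ∑ m, c m * (f.coeff p * ξ m ^ (p : ℕ)) := by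
          rw [eval_eq_sum_fin_of_natDegree_lt hdeg]
          refine Finset.sum_congr rfl fun p _ => ?_
          rw [h p, Finset.mul_sum]
          exact Finset.sum_congr rfl fun m _ => by ring
      _ = ∑ m, c m * f.eval (ξ m) := by
          rw [Finset.sum_comm]
          simp_rw [← Finset.mul_sum, ← eval_eq_sum_fin_of_natDegree_lt hdeg]
      _ = 0 := by simp [hroot]
  rw [hf, Polynomial.eval_prod, Finset.prod_eq_zero_iff] at hx
  obtain ⟨m, -, hm⟩ := hx
  exact ⟨m, by simpa [sub_eq_zero] using hm⟩

theorem stmt_16 (N P Q : ℕ) (hP : P ≥ N + 1) (hQ : Q ≥ N)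
    (ξ : Fin N → ℂ) (hξ : Function.Injective ξ) (hξ0 : ∀ m, ξ m ≠ 0)
    (τ : Fin N → ℂ) (hτ : ∀ m, τ m ≠ 0)
    (U : Matrix (Fin P) (Fin Q) ℂ)
    (hU : ∀ (p : Fin P) (q : Fin Q), U p q = ∑ m, τ m * ξ m ^ ((p : ℕ) + (q : ℕ) + 1))
    (ξ₀ : ℂ) (φ : Fin P → ℂ) (hφ : ∀ p : Fin P, φ p = ξ₀ ^ (p : ℕ)) :
    φ ∈ LinearMap.range U.mulVecLin ↔ ∃ m : Fin N, ξ₀ = ξ m := by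
  have hmul (a : Fin Q → ℂ) (p : Fin P) : U.mulVecLin a p =
      ∑ m, τ m * ξ m * (∑ q, a q * ξ m ^ (q : ℕ)) * ξ m ^ (p : ℕ) := by
    simp only [Matrix.mulVecLin_apply, Matrix.mulVec, dotProduct, hU, Finset.sum_mul,
      Finset.mul_sum]
    rw [Finset.sum_comm]
    exact Finset.sum_congr rfl fun m _ => Finset.sum_congr rfl fun q _ => by ring
  constructor
  · rintro ⟨a, ha⟩
    refine exists_eq_of_pow_eq_sum hP ξ (fun m => τ m * ξ m * ∑ q, a q * ξ m ^ (q : ℕ)) ξ₀ ?_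
    intro p
    rw [← hφ, ← ha, hmul]
  · rintro ⟨k, rfl⟩
    set L := Lagrange.basis Finset.univ ξ k with hL
    have hdeg : L.natDegree < Q := by
      have hd : L.natDegree = N - 1 := by
        apply Polynomial.natDegree_eq_of_degree_eq_some
        simpa using Lagrange.degree_basis (hξ.injOn (s := (Finset.univ : Finset (Fin N))))
          (Finset.mem_univ k)
      have := k.isLt
      omega
    refine ⟨fun q => (τ k * ξ k)⁻¹ * L.coeff q, funext fun p => ?_⟩
    rw [hmul, hφ]
    simp_rw [mul_assoc (τ k * ξ k)⁻¹, ← Finset.mul_sum,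
      ← eval_eq_sum_fin_of_natDegree_lt hdeg]
    rw [Finset.sum_eq_single k]
    · rw [hL, Lagrange.eval_basis_self hξ.injOn (Finset.mem_univ k), mul_one,
        mul_inv_cancel₀ (mul_ne_zero (hτ k) (hξ0 k)), one_mul]
    · intro m _ hm
      rw [hL, Lagrange.eval_basis_of_ne hm.symm (Finset.mem_univ m)]
      simp
    · simp
end

section
/- Let k > 0, let M ≥ 1, let x̂ ∈ EuclideanSpace ℝ (Fin 3) with ‖x̂‖ = 1, let z : Fin M → EuclideanSpace ℝ (Fin 3), and let τ : Fin M → ℂ. Then the function r ↦ r · exp(−I·k·r) · ∑ m, τ m · exp(I·k·‖r • x̂ − z m‖) / (4π·‖r • x̂ − z m‖) (of the real variable r) tends to (1/(4π)) · ∑ m, τ m · exp(−I·k·⟪x̂, z m⟫) as r → ∞ (Filter.Tendsto along Filter.atTop). -/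
open scoped RealInnerProductSpace

open Filter Topology

section Distance

variable {E : Type*} [NormedAddCommGroup E] [InnerProductSpace ℝ E]

theorem tendsto_norm_smul_sub_div_atTop {x : E} (hx : ‖x‖ = 1) (z : E) :
    Tendsto (fun r : ℝ => ‖r • x - z‖ / r) atTop (𝓝 1) := by
  have h : Tendsto (fun r : ℝ => ‖x - r⁻¹ • z‖) atTop (𝓝 1) := by
    have h0 := (tendsto_const_nhds (x := x)).sub
      ((tendsto_inv_atTop_zero (𝕜 := ℝ)).smul_const z)
    simpa [hx] using h0.norm
  refine h.congr' ?_
  filter_upwards [eventually_gt_atTop 0] with r hr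
  have : r • x - z = r • (x - r⁻¹ • z) := by
    rw [smul_sub, smul_inv_smul₀ hr.ne']
  rw [this, norm_smul, Real.norm_of_nonneg hr.le, mul_div_cancel_left₀ _ hr.ne']

theorem tendsto_norm_smul_sub_sub_atTop {x : E} (hx : ‖x‖ = 1) (z : E) :
    Tendsto (fun r : ℝ => ‖r • x - z‖ - r) atTop (𝓝 (-⟪x, z⟫)) := by
  have h : Tendsto (fun r : ℝ => (‖z‖ ^ 2 * r⁻¹ - 2 * ⟪x, z⟫) / (‖r • x - z‖ / r + 1)) atTop
      (𝓝 ((‖z‖ ^ 2 * 0 - 2 * ⟪x, z⟫) / (1 + 1))) :=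
    ((tendsto_inv_atTop_zero.const_mul _).sub_const _).div
      ((tendsto_norm_smul_sub_div_atTop hx z).add_const 1) (by norm_num)
  have hlim : (‖z‖ ^ 2 * 0 - 2 * ⟪x, z⟫) / (1 + 1) = -⟪x, z⟫ := by ring
  rw [hlim] at h
  refine h.congr' ?_
  filter_upwards [eventually_gt_atTop 0] with r hr
  have hsq : ‖r • x - z‖ ^ 2 = r ^ 2 - 2 * (r * ⟪x, z⟫) + ‖z‖ ^ 2 := by
    rw [norm_sub_sq_real, norm_smul, hx, real_inner_smul_left, mul_one, Real.norm_eq_abs, sq_abs]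
  have hpos : 0 < ‖r • x - z‖ / r + 1 := by positivity
  rw [div_eq_iff hpos.ne']
  field_simp
  linarith

end Distance

theorem stmt_18 (k : ℝ) (hk : 0 < k) (M : ℕ) (hM : 1 ≤ M)
    (xhat : EuclideanSpace ℝ (Fin 3)) (hx : ‖xhat‖ = 1)
    (z : Fin M → EuclideanSpace ℝ (Fin 3)) (τ : Fin M → ℂ) :
    Filter.Tendsto (fun r : ℝ => (r : ℂ) * Complex.exp (-Complex.I * k * r) *
        ∑ m, τ m * Complex.exp (Complex.I * k * ‖r • xhat - z m‖) /
          (4 * Real.pi * ‖r • xhat - z m‖))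
      Filter.atTop
      (nhds ((1 / (4 * (Real.pi : ℂ))) * ∑ m, τ m * Complex.exp (-Complex.I * k * ⟪xhat, z m⟫)))
    := by
  simp only [Finset.mul_sum]
  refine tendsto_finsetSum _ fun m _ => ?_
  have hratio : Tendsto (fun r : ℝ => (((‖r • xhat - z m‖ / r)⁻¹ : ℝ) : ℂ)) atTop (𝓝 1) := by
    have h := (tendsto_norm_smul_sub_div_atTop hx (z m)).inv₀ one_ne_zero
    rw [inv_one] at h
    exact_mod_cast (Complex.continuous_ofReal.tendsto 1).comp h
  have hphase : Tendsto
      (fun r : ℝ => Complex.exp (Complex.I * k * ((‖r • xhat - z m‖ - r : ℝ) : ℂ))) atTop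
      (𝓝 (Complex.exp (Complex.I * k * ((-⟪xhat, z m⟫ : ℝ) : ℂ)))) :=
    (((Complex.continuous_ofReal.tendsto _).comp
      (tendsto_norm_smul_sub_sub_atTop hx (z m))).const_mul _).cexp
  convert (hratio.mul hphase).const_mul (1 / (4 * (Real.pi : ℂ)) * τ m) using 2 with r
  · have hexp : Complex.exp (Complex.I * k * ((‖r • xhat - z m‖ - r : ℝ) : ℂ)) =
        Complex.exp (-Complex.I * k * r) * Complex.exp (Complex.I * k * ‖r • xhat - z m‖) := by
      rw [← Complex.exp_add]
      push_cast
      ring_nf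
    rw [hexp]
    push_cast
    rw [inv_div]
    simp only [div_eq_mul_inv, mul_inv]
    ring
  · push_cast
    ring_nf
end
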